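/- Let M = Γ(K,v) be an (H,u)-perfect pseudo MV-algebra with (H,u)-decomposition (M_t : t ∈ [0,u]_H). Define π : M → Γ(H,u) by π(x) = t iff x ∈ M_t. Then π is a surjective homomorphism of pseudo MV-algebras from M onto Γ(H,u) (i.e. π(x ⊕ y) = π(x) ⊕ π(y), π(x⁻) = π(x)⁻, π(x∼) = π(x)∼, π(0) = 0, π(v) = u) and π⁻¹({0}) = M_0; consequently the quotient M/M_0 is isomorphic to Γ(H,u). -/

import Mathlib

open Pointwise

/-- `v` is a strong (order) unit of an ordered group: `v ≥ 0` and every element is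
dominated by some positive multiple of `v`. -/
def IsStrongOrderUnit {G : Type*} [AddMonoid G] [PartialOrder G] (v : G) : Prop :=
  0 ≤ v ∧ ∀ g : G, ∃ n : ℕ, 0 < n ∧ g ≤ n • v

section Decomposition

variable {H : Type*} [AddGroup H] [LinearOrder H]
  [CovariantClass H H (· + ·) (· ≤ ·)]
  [CovariantClass H H (Function.swap (· + ·)) (· ≤ ·)]
variable {K : Type*} [AddGroup K] [Lattice K]
  [CovariantClass K K (· + ·) (· ≤ ·)]
  [CovariantClass K K (Function.swap (· + ·)) (· ≤ ·)]

/-- An `(H,u)`-decomposition of the pseudo MV-algebra `M = Γ(K,v)`: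
a family `(Mt t : t ∈ [0,u]_H)` of nonempty, pairwise disjoint subsets of `[0,v]`
covering `[0,v]` such that (a) `Mt s ≤ Mt t` for `s < t`;
(b) `(Mt t)⁻ = Mt (u - t)` and `(Mt t)∼ = Mt (-t + u)` (here `x⁻ = v - x`, `x∼ = -x + v`);
(c) `x ⊕ y = (x + y) ⊓ v ∈ Mt (min (s+t) u)` whenever `x ∈ Mt s`, `y ∈ Mt t`. -/
structure IsHuDecomposition (u : H) (v : K) (Mt : H → Set K) : Prop where
  nonempty : ∀ t ∈ Set.Icc (0 : H) u, (Mt t).Nonempty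
  subset_carrier : ∀ t ∈ Set.Icc (0 : H) u, Mt t ⊆ Set.Icc (0 : K) v
  pairwise_disjoint : ∀ s ∈ Set.Icc (0 : H) u, ∀ t ∈ Set.Icc (0 : H) u,
    s ≠ t → Disjoint (Mt s) (Mt t)
  cover : ∀ x ∈ Set.Icc (0 : K) v, ∃ t ∈ Set.Icc (0 : H) u, x ∈ Mt t
  le_of_lt : ∀ s ∈ Set.Icc (0 : H) u, ∀ t ∈ Set.Icc (0 : H) u, s < t →
    ∀ a ∈ Mt s, ∀ b ∈ Mt t, a ≤ b
  compl_image : ∀ t ∈ Set.Icc (0 : H) u, (fun x => v - x) '' Mt t = Mt (u - t)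
  sim_image : ∀ t ∈ Set.Icc (0 : H) u, (fun x => -x + v) '' Mt t = Mt (-t + u)
  oplus_mem : ∀ s ∈ Set.Icc (0 : H) u, ∀ t ∈ Set.Icc (0 : H) u,
    ∀ x ∈ Mt s, ∀ y ∈ Mt t, (x + y) ⊓ v ∈ Mt (min (s + t) u)

/-- Let `M = Γ(K,v)` be `(H,u)`-perfect with `(H,u)`-decomposition
`(Mt t)` and let `π : M → Γ(H,u)` be defined by `π x = t` iff `x ∈ Mt t`. Then `π` is
a surjective homomorphism of pseudo MV-algebras from `M` onto `Γ(H,u)` (it preserves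
`⊕`, `⁻`, `∼`, `0`, `1`) and `π⁻¹({0}) = Mt 0`; consequently `M / (Mt 0) ≅ Γ(H,u)`. -/
theorem statement_6 (u : H) (v : K) (hu : 0 < u)
    (hsuH : IsStrongOrderUnit u) (hsuK : IsStrongOrderUnit v)
    (Mt : H → Set K) (hdec : IsHuDecomposition u v Mt)
    (π : K → H) (hπ : ∀ t ∈ Set.Icc (0 : H) u, ∀ x ∈ Mt t, π x = t) :
    (∀ x ∈ Set.Icc (0 : K) v, π x ∈ Set.Icc (0 : H) u) ∧
    (∀ t ∈ Set.Icc (0 : H) u, ∃ x ∈ Set.Icc (0 : K) v, π x = t) ∧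
    (∀ x ∈ Set.Icc (0 : K) v, ∀ y ∈ Set.Icc (0 : K) v,
      π ((x + y) ⊓ v) = min (π x + π y) u) ∧
    (∀ x ∈ Set.Icc (0 : K) v, π (v - x) = u - π x) ∧
    (∀ x ∈ Set.Icc (0 : K) v, π (-x + v) = -(π x) + u) ∧
    π 0 = 0 ∧ π v = u ∧
    (∀ x ∈ Set.Icc (0 : K) v, (π x = 0 ↔ x ∈ Mt 0)) := by
  have hπ_mem : ∀ x ∈ Set.Icc (0 : K) v, π x ∈ Set.Icc (0 : H) u ∧ x ∈ Mt (π x) := by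
    intro x hx
    obtain ⟨t, ht, hxt⟩ := hdec.cover x hx
    rw [hπ t ht x hxt]
    exact ⟨ht, hxt⟩
  have h0u : (0 : H) ∈ Set.Icc (0 : H) u := ⟨le_rfl, hu.le⟩
  have h0v : (0 : K) ∈ Set.Icc (0 : K) v := ⟨le_rfl, hsuK.1⟩
  have hcompl : ∀ x ∈ Set.Icc (0 : K) v, π (v - x) = u - π x := by
    intro x hx
    obtain ⟨ht, hxt⟩ := hπ_mem x hx
    refine hπ _ ⟨sub_nonneg.2 ht.2, sub_le_self u ht.1⟩ _ ?_
    rw [← hdec.compl_image _ ht]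
    exact Set.mem_image_of_mem _ hxt
  have hzero : π 0 = 0 := by
    obtain ⟨ht, hxt⟩ := hπ_mem 0 h0v
    by_contra hne
    obtain ⟨a, ha⟩ := hdec.nonempty 0 h0u
    have ha0 : a = 0 :=
      le_antisymm (hdec.le_of_lt 0 h0u _ ht (lt_of_le_of_ne ht.1 (Ne.symm hne)) a ha 0 hxt)
        (hdec.subset_carrier 0 h0u ha).1
    exact hne (hπ 0 h0u 0 (ha0 ▸ ha))
  refine ⟨fun x hx => (hπ_mem x hx).1, ?_, ?_, hcompl, ?_, hzero, ?_, ?_⟩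
  · intro t ht
    obtain ⟨x, hx⟩ := hdec.nonempty t ht
    exact ⟨x, hdec.subset_carrier t ht hx, hπ t ht x hx⟩
  · intro x hx y hy
    obtain ⟨hs, hxs⟩ := hπ_mem x hx
    obtain ⟨ht, hyt⟩ := hπ_mem y hy
    exact hπ _ ⟨le_min (add_nonneg hs.1 ht.1) hu.le, min_le_right _ _⟩ _
      (hdec.oplus_mem _ hs _ ht x hxs y hyt)
  · intro x hx
    obtain ⟨ht, hxt⟩ := hπ_mem x hx
    refine hπ _ ⟨?_, ?_⟩ _ ?_
    · exact le_neg_add_iff_add_le.2 (by simpa using ht.2)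
    · exact neg_add_le_iff_le_add.2 (le_add_of_nonneg_left ht.1)
    · rw [← hdec.sim_image _ ht]
      exact Set.mem_image_of_mem _ hxt
  · simpa [hzero] using hcompl 0 h0v
  · intro x hx
    exact ⟨fun h => h ▸ (hπ_mem x hx).2, hπ 0 h0u x⟩
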